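/- arXiv:2007.01709 — 2 statements merged into one kernel-verified Lean document; each statement's English description precedes it below -/
import Mathlib

section
/- Let Γ_s be a maximal consistent set of formulas of sort s in H_Σ(@_z) that contains a state symbol of sort s, and for each state symbol z of sort t let Δ_z = {φ of sort t : @_z^s φ ∈ Γ_s}. Then for all state symbols z and y of the same sort t, if z ∈ Δ_y then Δ_z = Δ_y. -/
set_option autoImplicit false

namespace HybridMSHL

/-- A many-sorted signature `(S, Σ)`: a set of sorts and operation symbols
`σ : s1 ⋯ sn → s` given by a domain list of sorts and a codomain sort. -/
structure MSig where
  S : Type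
  Op : Type
  dom : Op → List S
  cod : Op → S

abbrev MSig.arity (Sg : MSig) (σ : Sg.Op) : Type := Fin (Sg.dom σ).length

abbrev MSig.argSort (Sg : MSig) {σ : Sg.Op} (i : Sg.arity σ) : Sg.S := (Sg.dom σ).get i

/-- State symbols of sort `t`: nominals or state variables. -/
abbrev SSym {SS : Type} (N X : SS → Type) (t : SS) : Type := N t ⊕ X t

/-- Formulas of `H_Σ(@_z)` over propositional variables `P`, nominals `N`
and state variables `X`, indexed by their sort. -/
inductive Form (Sg : MSig) (P N X : Sg.S → Type) : Sg.S → Type where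
  | prop {s : Sg.S} : P s → Form Sg P N X s
  | nom  {s : Sg.S} : N s → Form Sg P N X s
  | svar {s : Sg.S} : X s → Form Sg P N X s
  | neg  {s : Sg.S} : Form Sg P N X s → Form Sg P N X s
  | or   {s : Sg.S} : Form Sg P N X s → Form Sg P N X s → Form Sg P N X s
  | op   (σ : Sg.Op) : ((i : Sg.arity σ) → Form Sg P N X (Sg.argSort i)) →
           Form Sg P N X (Sg.cod σ)
  | atf  {t s : Sg.S} : SSym N X t → Form Sg P N X t → Form Sg P N X s

namespace Form

variable {Sg : MSig} {P N X : Sg.S → Type}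

def impl {s : Sg.S} (φ ψ : Form Sg P N X s) : Form Sg P N X s := .or (.neg φ) ψ

def conj {s : Sg.S} (φ ψ : Form Sg P N X s) : Form Sg P N X s :=
  .neg (.or (.neg φ) (.neg ψ))

def equiv {s : Sg.S} (φ ψ : Form Sg P N X s) : Form Sg P N X s :=
  conj (impl φ ψ) (impl ψ φ)

/-- The dual operator `σ□(φ_1,…,φ_n) := ¬σ(¬φ_1,…,¬φ_n)`. -/
def box (σ : Sg.Op) (args : (i : Sg.arity σ) → Form Sg P N X (Sg.argSort i)) :
    Form Sg P N X (Sg.cod σ) := .neg (.op σ fun i => .neg (args i))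

/-- A state symbol viewed as a formula of its sort. -/
def ofSSym {t : Sg.S} : SSym N X t → Form Sg P N X t
  | .inl j => .nom j
  | .inr x => .svar x

/-- `bigConj φ [χ1,…,χn] = φ ∧ χ1 ∧ ⋯ ∧ χn`. -/
def bigConj {s : Sg.S} : Form Sg P N X s → List (Form Sg P N X s) → Form Sg P N X s
  | φ, [] => φ
  | φ, χ :: l => conj φ (bigConj χ l)

/-- `φ` is a propositional tautology: it evaluates to true under every
assignment of truth values to formulas which is compatible with `¬` and `∨`
(all non-Boolean formulas are treated as propositional atoms). -/
def Tautology {s : Sg.S} (φ : Form Sg P N X s) : Prop :=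
  ∀ v : ∀ t, Form Sg P N X t → Prop,
    (∀ t (ψ : Form Sg P N X t), v t (.neg ψ) ↔ ¬ v t ψ) →
    (∀ t (ψ χ : Form Sg P N X t), v t (.or ψ χ) ↔ (v t ψ ∨ v t χ)) →
    v s φ

/-- Occurrence of the nominal `y` (of sort `u`) in a formula. -/
def nomOcc {u : Sg.S} (y : N u) : {s : Sg.S} → Form Sg P N X s → Prop
  | _, .prop _ => False
  | _, .nom j => (⟨_, j⟩ : Σ t, N t) = ⟨u, y⟩
  | _, .svar _ => False
  | _, .neg φ => nomOcc y φ
  | _, .or φ ψ => nomOcc y φ ∨ nomOcc y ψ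
  | _, .op _ args => ∃ i, nomOcc y (args i)
  | _, .atf z φ =>
      (match z with
        | .inl j => (⟨_, j⟩ : Σ t, N t) = ⟨u, y⟩
        | .inr _ => False) ∨ nomOcc y φ

end Form

/-- The deductive system `H_Σ(@_z)` (with an extra set `Λ` of axioms,
`Λ = ∅` gives the plain system). -/
inductive Prf {Sg : MSig} {P N X : Sg.S → Type} (Λ : ∀ s, Set (Form Sg P N X s)) :
    {s : Sg.S} → Form Sg P N X s → Prop where
  | extra {s : Sg.S} {φ : Form Sg P N X s} : φ ∈ Λ s → Prf Λ φ
  | taut {s : Sg.S} {φ : Form Sg P N X s} : φ.Tautology → Prf Λ φ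
  | axK (σ : Sg.Op) (args : (i : Sg.arity σ) → Form Sg P N X (Sg.argSort i))
      (i : Sg.arity σ) (φ χ : Form Sg P N X (Sg.argSort i)) :
      Prf Λ (Form.impl (Form.box σ (Function.update args i (Form.impl φ χ)))
        (Form.impl (Form.box σ (Function.update args i φ))
          (Form.box σ (Function.update args i χ))))
  | axDual (σ : Sg.Op) (args : (i : Sg.arity σ) → Form Sg P N X (Sg.argSort i)) :
      Prf Λ (Form.equiv (Form.op σ args)
        (Form.neg (Form.box σ fun i => Form.neg (args i))))
  | axKat {s t : Sg.S} (z : SSym N X t) (φ ψ : Form Sg P N X t) :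
      Prf Λ (Form.impl (Form.atf (s := s) z (Form.impl φ ψ))
        (Form.impl (Form.atf (s := s) z φ) (Form.atf (s := s) z ψ)))
  | axSelfDual {s t : Sg.S} (z : SSym N X t) (φ : Form Sg P N X t) :
      Prf Λ (Form.equiv (Form.atf (s := s) z φ)
        (Form.neg (Form.atf (s := s) z (Form.neg φ))))
  | axIntro {s : Sg.S} (z : SSym N X s) (φ : Form Sg P N X s) :
      Prf Λ (Form.impl (Form.ofSSym z) (Form.equiv φ (Form.atf (s := s) z φ)))
  | axAgree {t a b : Sg.S} (y : SSym N X a) (z : SSym N X b) (φ : Form Sg P N X b) :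
      Prf Λ (Form.equiv (Form.atf (s := t) y (Form.atf (s := a) z φ))
        (Form.atf (s := t) z φ))
  | axRef {s t : Sg.S} (z : SSym N X t) : Prf Λ (Form.atf (s := s) z (Form.ofSSym z))
  | axBack (σ : Sg.Op) (args : (i : Sg.arity σ) → Form Sg P N X (Sg.argSort i))
      (i : Sg.arity σ) {t : Sg.S} (z : SSym N X t) (ψ : Form Sg P N X t) :
      Prf Λ (Form.impl
        (Form.op σ (Function.update args i (Form.atf (s := Sg.argSort i) z ψ)))
        (Form.atf (s := Sg.cod σ) z ψ))
  | mp {s : Sg.S} {φ ψ : Form Sg P N X s} : Prf Λ (Form.impl φ ψ) → Prf Λ φ → Prf Λ ψ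
  | ug (σ : Sg.Op) (args : (i : Sg.arity σ) → Form Sg P N X (Sg.argSort i))
      (i : Sg.arity σ) {φ : Form Sg P N X (Sg.argSort i)} :
      Prf Λ φ → Prf Λ (Form.box σ (Function.update args i φ))
  | broadcast {s s' t : Sg.S} (z : SSym N X t) (φ : Form Sg P N X t) :
      Prf Λ (Form.atf (s := s) z φ) → Prf Λ (Form.atf (s := s') z φ)
  | genAt {s t : Sg.S} (z : SSym N X t) (φ : Form Sg P N X t) :
      Prf Λ φ → Prf Λ (Form.atf (s := s) z φ)
  | paste0 {s t : Sg.S} (z : SSym N X t) (y : N t) (φ : Form Sg P N X t)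
      (ψ : Form Sg P N X s) :
      Sum.inl y ≠ z → ¬ Form.nomOcc y φ → ¬ Form.nomOcc y ψ →
      Prf Λ (Form.impl (Form.atf (s := s) z (Form.conj (Form.nom y) φ)) ψ) →
      Prf Λ (Form.impl (Form.atf (s := s) z φ) ψ)
  | paste1 {s : Sg.S} (σ : Sg.Op) (args : (i : Sg.arity σ) → Form Sg P N X (Sg.argSort i))
      (i : Sg.arity σ) (z : SSym N X (Sg.cod σ)) (y : N (Sg.argSort i))
      (φ : Form Sg P N X (Sg.argSort i)) (ψ : Form Sg P N X s) :
      (⟨_, Sum.inl y⟩ : Σ t, SSym N X t) ≠ ⟨_, z⟩ →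
      ¬ Form.nomOcc y φ → ¬ Form.nomOcc y ψ →
      Prf Λ (Form.impl
        (Form.atf (s := s) z (Form.op σ (Function.update args i (Form.conj (Form.nom y) φ)))) ψ) →
      Prf Λ (Form.impl (Form.atf (s := s) z (Form.op σ (Function.update args i φ))) ψ)

/-- The plain system `H_Σ(@_z)`: no extra axioms. -/
def NoAx {Sg : MSig} {P N X : Sg.S → Type} : ∀ s, Set (Form Sg P N X s) := fun _ => ∅

/-- `⊢_s φ` in `H_Σ(@_z)`. -/
def Thm {Sg : MSig} {P N X : Sg.S → Type} {s : Sg.S} (φ : Form Sg P N X s) : Prop :=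
  Prf NoAx φ

/-- An `(S,Σ)`-model: nonempty sorted worlds, relations interpreting the
operation symbols, a valuation of propositional variables and a valuation of
nominals (each nominal denotes a singleton, i.e. a single world). -/
structure Model (Sg : MSig) (P N : Sg.S → Type) where
  W : Sg.S → Type
  Wne : ∀ s, Nonempty (W s)
  R : (σ : Sg.Op) → W (Sg.cod σ) → ((i : Sg.arity σ) → W (Sg.argSort i)) → Prop
  Vp : ∀ s, P s → Set (W s)
  Vn : ∀ s, N s → W s

variable {Sg : MSig} {P N X : Sg.S → Type}

/-- Denotation of a state symbol under an assignment. -/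
def Model.den (M : Model Sg P N) (g : ∀ t, X t → M.W t) {t : Sg.S} :
    SSym N X t → M.W t
  | .inl j => M.Vn t j
  | .inr x => g t x

/-- The satisfaction relation `M,g,w ⊨_s φ`. -/
def Sat' (M : Model Sg P N) (g : ∀ t, X t → M.W t) :
    {s : Sg.S} → Form Sg P N X s → M.W s → Prop
  | _, .prop p, w => w ∈ M.Vp _ p
  | _, .nom j, w => w = M.Vn _ j
  | _, .svar x, w => w = g _ x
  | _, .neg φ, w => ¬ Sat' M g φ w
  | _, .or φ ψ, w => Sat' M g φ w ∨ Sat' M g ψ w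
  | _, .op σ args, w => ∃ u : (i : Sg.arity σ) → M.W (Sg.argSort i),
      M.R σ w u ∧ ∀ i, Sat' M g (args i) (u i)
  | _, .atf z φ, _ => Sat' M g φ (M.den g z)

/-- The satisfaction relation `M,g,w ⊨_s φ`. -/
abbrev Sat (M : Model Sg P N) (g : ∀ t, X t → M.W t) {s : Sg.S}
    (w : M.W s) (φ : Form Sg P N X s) : Prop := Sat' M g φ w

/-- A model is named if every world is the denotation of some nominal. -/
def Model.Named (M : Model Sg P N) : Prop :=
  ∀ s (w : M.W s), ∃ j : N s, M.Vn s j = w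

/-- `Γ` is consistent: no finite list of its members has a provably false
conjunction. -/
def Consistent (Λ : ∀ s, Set (Form Sg P N X s)) {s : Sg.S}
    (Γ : Set (Form Sg P N X s)) : Prop :=
  ¬ ∃ (φ : Form Sg P N X s) (l : List (Form Sg P N X s)),
      φ ∈ Γ ∧ (∀ χ ∈ l, χ ∈ Γ) ∧ Prf Λ (Form.neg (Form.bigConj φ l))

/-- `Γ` is maximal consistent. -/
def MaxConsistent (Λ : ∀ s, Set (Form Sg P N X s)) {s : Sg.S}
    (Γ : Set (Form Sg P N X s)) : Prop :=
  Consistent Λ Γ ∧ ∀ φ : Form Sg P N X s, φ ∈ Γ ∨ Form.neg φ ∈ Γ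

/-- `Δ_z = {φ : @_z φ ∈ Γ}`. -/
def Dset {s : Sg.S} (Γ : Set (Form Sg P N X s)) {t : Sg.S} (z : SSym N X t) :
    Set (Form Sg P N X t) :=
  {φ | (Form.atf (s := s) z φ) ∈ Γ}

/-- `Γ` is named if it contains a nominal. -/
def NamedSet {s : Sg.S} (Γ : Set (Form Sg P N X s)) : Prop :=
  ∃ j : N s, Form.nom j ∈ Γ

def Pasted0 {s : Sg.S} (Γ : Set (Form Sg P N X s)) : Prop :=
  ∀ (t : Sg.S) (z : SSym N X t) (φ : Form Sg P N X t),
    (Form.atf (s := s) z φ) ∈ Γ →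
    ∃ j : N t, (Form.atf (s := s) z (Form.conj (Form.nom j) φ)) ∈ Γ

def Pasted1 {s : Sg.S} (Γ : Set (Form Sg P N X s)) : Prop :=
  ∀ (σ : Sg.Op) (z : SSym N X (Sg.cod σ))
    (args : (i : Sg.arity σ) → Form Sg P N X (Sg.argSort i)) (i : Sg.arity σ),
    (Form.atf (s := s) z (Form.op σ args)) ∈ Γ →
    ∃ j : N (Sg.argSort i),
      (Form.atf (s := s) z
        (Form.op σ (Function.update args i (Form.conj (Form.nom j) (args i))))) ∈ Γ

def PastedSet {s : Sg.S} (Γ : Set (Form Sg P N X s)) : Prop :=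
  Pasted0 Γ ∧ Pasted1 Γ

/-- Worlds of the named (canonical) model generated by an `S`-sorted family `Γfam`:
the sets `Δ_z` for state symbols `z` of the given sort. -/
def CWorld (Γfam : ∀ t, Set (Form Sg P N X t)) (t : Sg.S) : Type :=
  {Δ : Set (Form Sg P N X t) // ∃ z : SSym N X t, Δ = Dset (Γfam t) z}

/-- The canonical relations. -/
def CRel (Γfam : ∀ t, Set (Form Sg P N X t)) (σ : Sg.Op)
    (w : CWorld Γfam (Sg.cod σ)) (u : (i : Sg.arity σ) → CWorld Γfam (Sg.argSort i)) : Prop :=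
  ∀ args : (i : Sg.arity σ) → Form Sg P N X (Sg.argSort i),
    (∀ i, args i ∈ (u i).1) → Form.op σ args ∈ w.1

/-- The named (canonical) model generated by `Γfam`. -/
noncomputable def canModel (Γfam : ∀ t, Set (Form Sg P N X t))
    [inst : ∀ t, Nonempty (N t)] : Model Sg P N where
  W := CWorld Γfam
  Wne := fun t => ⟨⟨Dset (Γfam t) (Sum.inl (Classical.arbitrary (N t))), ⟨_, rfl⟩⟩⟩
  R := CRel Γfam
  Vp := fun s p => {w : CWorld Γfam s | Form.prop p ∈ w.1}
  Vn := fun t j => ⟨Dset (Γfam t) (Sum.inl j), ⟨_, rfl⟩⟩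

/-- The natural assignment: a state variable `x` is sent to the world `Δ_x`. -/
def natAssign (Γfam : ∀ t, Set (Form Sg P N X t)) :
    ∀ t, X t → CWorld Γfam t := fun t x => ⟨Dset (Γfam t) (Sum.inr x), ⟨_, rfl⟩⟩

/-- Translation of formulas into the language with countably many new
nominals added to every sort. -/
def Form.extNom : {s : Sg.S} → Form Sg P N X s → Form Sg P (fun t => N t ⊕ ℕ) X s
  | _, .prop p => .prop p
  | _, .nom j => .nom (Sum.inl j)
  | _, .svar x => .svar x
  | _, .neg φ => .neg φ.extNom
  | _, .or φ ψ => .or φ.extNom ψ.extNom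
  | _, .op σ args => .op σ fun i => (args i).extNom
  | _, .atf z φ => .atf (Sum.map Sum.inl id z) φ.extNom


theorem Form.Tautology.equiv_left {s : Sg.S} (φ ψ : Form Sg P N X s) :
    (Form.impl (Form.equiv φ ψ) (Form.impl φ ψ)).Tautology := by
  intro v hn ho
  simp only [Form.impl, Form.equiv, Form.conj, hn, ho]
  tauto

theorem Form.Tautology.equiv_right {s : Sg.S} (φ ψ : Form Sg P N X s) :
    (Form.impl (Form.equiv φ ψ) (Form.impl ψ φ)).Tautology := by
  intro v hn ho
  simp only [Form.impl, Form.equiv, Form.conj, hn, ho]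
  tauto

namespace MaxConsistent

variable {Λ : ∀ s, Set (Form Sg P N X s)}

theorem mem_of_prf {s : Sg.S} {Γ : Set (Form Sg P N X s)} (hΓ : MaxConsistent Λ Γ)
    {φ : Form Sg P N X s} (h : Prf Λ φ) : φ ∈ Γ := by
  refine (hΓ.2 φ).resolve_right fun hn => hΓ.1 ⟨_, [], hn, by simp, ?_⟩
  refine .mp (.taut ?_) h
  intro v hn ho
  simp only [Form.impl, Form.bigConj, hn, ho]
  tauto

theorem mem_of_impl_mem {s : Sg.S} {Γ : Set (Form Sg P N X s)} (hΓ : MaxConsistent Λ Γ)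
    {φ ψ : Form Sg P N X s} (h : Form.impl φ ψ ∈ Γ) (hφ : φ ∈ Γ) : ψ ∈ Γ := by
  refine (hΓ.2 ψ).resolve_right fun hψ =>
    hΓ.1 ⟨_, [φ, Form.neg ψ], h, by simp [hφ, hψ], .taut ?_⟩
  intro v hn ho
  simp only [Form.impl, Form.bigConj, Form.conj, hn, ho]
  tauto

theorem mem_iff_of_equiv_mem {s : Sg.S} {Γ : Set (Form Sg P N X s)} (hΓ : MaxConsistent Λ Γ)
    {φ ψ : Form Sg P N X s} (h : Form.equiv φ ψ ∈ Γ) : φ ∈ Γ ↔ ψ ∈ Γ :=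
  ⟨hΓ.mem_of_impl_mem
      (hΓ.mem_of_impl_mem (hΓ.mem_of_prf (.taut (.equiv_left φ ψ))) h),
    hΓ.mem_of_impl_mem
      (hΓ.mem_of_impl_mem (hΓ.mem_of_prf (.taut (.equiv_right φ ψ))) h)⟩

theorem mem_dset_of_prf {s t : Sg.S} {Γ : Set (Form Sg P N X s)} (hΓ : MaxConsistent Λ Γ)
    (z : SSym N X t) {φ : Form Sg P N X t} (h : Prf Λ φ) : φ ∈ Dset Γ z :=
  hΓ.mem_of_prf (.genAt z φ h)

theorem mem_dset_of_impl_mem {s t : Sg.S} {Γ : Set (Form Sg P N X s)}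
    (hΓ : MaxConsistent Λ Γ) {z : SSym N X t} {φ ψ : Form Sg P N X t}
    (h : Form.impl φ ψ ∈ Dset Γ z) (hφ : φ ∈ Dset Γ z) : ψ ∈ Dset Γ z :=
  hΓ.mem_of_impl_mem (hΓ.mem_of_impl_mem (hΓ.mem_of_prf (.axKat z φ ψ)) h) hφ

theorem mem_dset_iff_of_equiv_mem {s t : Sg.S} {Γ : Set (Form Sg P N X s)}
    (hΓ : MaxConsistent Λ Γ) {z : SSym N X t} {φ ψ : Form Sg P N X t}
    (h : Form.equiv φ ψ ∈ Dset Γ z) : φ ∈ Dset Γ z ↔ ψ ∈ Dset Γ z :=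
  ⟨hΓ.mem_dset_of_impl_mem
      (hΓ.mem_dset_of_impl_mem (hΓ.mem_dset_of_prf z (.taut (.equiv_left φ ψ))) h),
    hΓ.mem_dset_of_impl_mem
      (hΓ.mem_dset_of_impl_mem (hΓ.mem_dset_of_prf z (.taut (.equiv_right φ ψ))) h)⟩

theorem atf_mem_dset_iff {s a b : Sg.S} {Γ : Set (Form Sg P N X s)} (hΓ : MaxConsistent Λ Γ)
    (y : SSym N X a) (z : SSym N X b) (φ : Form Sg P N X b) :
    Form.atf z φ ∈ Dset Γ y ↔ φ ∈ Dset Γ z :=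
  hΓ.mem_iff_of_equiv_mem (hΓ.mem_of_prf (.axAgree y z φ))

end MaxConsistent

/-- If `z ∈ Δ_y` then `Δ_z = Δ_y`. -/
theorem dset_eq_of_mem {s : Sg.S} (Γ : Set (Form Sg P N X s))
    (hΓ : MaxConsistent NoAx Γ) (hstate : ∃ z0 : SSym N X s, Form.ofSSym z0 ∈ Γ)
    {t : Sg.S} (z y : SSym N X t) (hzy : Form.ofSSym z ∈ Dset Γ y) :
    Dset Γ z = Dset Γ y := by
  ext φ
  have hφ : Form.equiv φ (Form.atf z φ) ∈ Dset Γ y :=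
    hΓ.mem_dset_of_impl_mem (hΓ.mem_dset_of_prf y (.axIntro z φ)) hzy
  exact ((hΓ.mem_dset_iff_of_equiv_mem hφ).trans (hΓ.atf_mem_dset_iff y z φ)).symm

end HybridMSHL
end

section
/- Completeness of H_Σ(@_z): every consistent set Γ_s of formulas of sort s is satisfiable, i.e. there exist an (S,Σ)-model M, an assignment g and a world w ∈ W_s such that M,g,w ⊨_s φ for every φ ∈ Γ_s. -/
set_option autoImplicit false

namespace HybridMSHL

variable {Sg : MSig} {P N X : Sg.S → Type}

/-! ### Propositional reasoning -/

theorem Prf.of_taut {Λ : ∀ s, Set (Form Sg P N X s)} {s : Sg.S} {φ ψ : Form Sg P N X s}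
    (h : (Form.impl φ ψ).Tautology) (hφ : Prf Λ φ) : Prf Λ ψ :=
  .mp (.taut h) hφ

theorem Prf.of_taut₂ {Λ : ∀ s, Set (Form Sg P N X s)} {s : Sg.S} {φ ψ χ : Form Sg P N X s}
    (h : (Form.impl φ (Form.impl ψ χ)).Tautology) (hφ : Prf Λ φ) (hψ : Prf Λ ψ) : Prf Λ χ :=
  .mp (.mp (.taut h) hφ) hψ

theorem Form.tautology_impl_self {s : Sg.S} (φ : Form Sg P N X s) :
    (Form.impl φ φ).Tautology := by
  intro v hn ho
  simp only [Form.impl, hn, ho]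
  tauto

theorem Form.bigConj_iff {v : ∀ t, Form Sg P N X t → Prop}
    (hn : ∀ t (ψ : Form Sg P N X t), v t (.neg ψ) ↔ ¬ v t ψ)
    (ho : ∀ t (ψ χ : Form Sg P N X t), v t (.or ψ χ) ↔ (v t ψ ∨ v t χ))
    {s : Sg.S} (l : List (Form Sg P N X s)) (φ : Form Sg P N X s) :
    v s (Form.bigConj φ l) ↔ v s φ ∧ ∀ χ ∈ l, v s χ := by
  induction l generalizing φ with
  | nil => simp [Form.bigConj]
  | cons χ l ih => simp [Form.bigConj, Form.conj, hn, ho, ih]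

/-- A set of formulas that contains all theorems and is closed under Modus Ponens. -/
structure IsTheory (Λ : ∀ s, Set (Form Sg P N X s)) {s : Sg.S}
    (T : Set (Form Sg P N X s)) : Prop where
  thm : ∀ {φ}, Prf Λ φ → φ ∈ T
  mp : ∀ {φ ψ}, Form.impl φ ψ ∈ T → φ ∈ T → ψ ∈ T

namespace IsTheory

variable {Λ : ∀ s, Set (Form Sg P N X s)} {s : Sg.S} {T : Set (Form Sg P N X s)}

theorem of_taut (hT : IsTheory Λ T) {φ ψ : Form Sg P N X s}
    (h : (Form.impl φ ψ).Tautology) (hφ : φ ∈ T) : ψ ∈ T :=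
  hT.mp (hT.thm (.taut h)) hφ

theorem of_taut₂ (hT : IsTheory Λ T) {φ ψ χ : Form Sg P N X s}
    (h : (Form.impl φ (Form.impl ψ χ)).Tautology) (hφ : φ ∈ T) (hψ : ψ ∈ T) : χ ∈ T :=
  hT.mp (hT.of_taut h hφ) hψ

/-- The theory generated by `T` and `φ`. -/
theorem adjoin (hT : IsTheory Λ T) (φ : Form Sg P N X s) :
    IsTheory Λ {χ | Form.impl φ χ ∈ T} where
  thm h := hT.of_taut
    (by intro v hn ho; simp only [Form.impl, hn, ho]; tauto) (hT.thm h)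
  mp h₁ h₂ := hT.of_taut₂
    (by intro v hn ho; simp only [Form.impl, hn, ho]; tauto) h₁ h₂

end IsTheory

theorem isTheory_setOf_prf_impl (Λ : ∀ s, Set (Form Sg P N X s)) {s : Sg.S}
    (φ : Form Sg P N X s) : IsTheory Λ {χ | Prf Λ (Form.impl φ χ)} :=
  IsTheory.adjoin (T := {χ | Prf Λ χ}) ⟨id, .mp⟩ φ

/-- The theory generated by a nonempty set of formulas. -/
theorem isTheory_generated (Λ : ∀ s, Set (Form Sg P N X s)) {s : Sg.S}
    {Γ : Set (Form Sg P N X s)} (hΓ : Γ.Nonempty) :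
    IsTheory Λ {χ | ∃ (φ : Form Sg P N X s) (l : List (Form Sg P N X s)),
      φ ∈ Γ ∧ (∀ ψ ∈ l, ψ ∈ Γ) ∧ Prf Λ (Form.impl (Form.bigConj φ l) χ)} where
  thm h := by
    obtain ⟨φ, hφ⟩ := hΓ
    exact ⟨φ, [], hφ, by simp, .of_taut
      (by intro v hn ho; simp only [Form.impl, hn, ho]; tauto) h⟩
  mp := by
    rintro χ ξ ⟨φ, l, hφ, hl, h⟩ ⟨φ', l', hφ', hl', h'⟩
    refine ⟨φ, l ++ φ' :: l', hφ, ?_, .of_taut₂ ?_ h h'⟩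
    · simp only [List.mem_append, List.mem_cons]
      rintro ψ (hψ | rfl | hψ)
      exacts [hl ψ hψ, hφ', hl' ψ hψ]
    · intro v hn ho
      simp only [Form.impl, hn, ho, Form.bigConj_iff hn ho, List.mem_append, List.mem_cons]
      grind

/-- A theory that contains exactly one of `φ`, `¬φ` for each formula `φ`. -/
structure IsComplete (Λ : ∀ s, Set (Form Sg P N X s)) {s : Sg.S}
    (T : Set (Form Sg P N X s)) : Prop extends IsTheory Λ T where
  neg_mem : ∀ φ, Form.neg φ ∈ T ↔ φ ∉ T

namespace IsComplete

variable {Λ : ∀ s, Set (Form Sg P N X s)} {s : Sg.S} {T : Set (Form Sg P N X s)}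

theorem or_mem (hT : IsComplete Λ T) (φ ψ : Form Sg P N X s) :
    Form.or φ ψ ∈ T ↔ φ ∈ T ∨ ψ ∈ T := by
  refine ⟨fun h => ?_, ?_⟩
  · by_contra! hc
    have h₁ := (hT.neg_mem φ).2 hc.1
    refine hc.2 (hT.of_taut₂ ?_ h h₁)
    intro v hn ho
    simp only [Form.impl, hn, ho]
    tauto
  · rintro (h | h) <;> refine hT.of_taut ?_ h <;> intro v hn ho <;>
      simp only [Form.impl, hn, ho] <;> tauto

theorem impl_mem (hT : IsComplete Λ T) (φ ψ : Form Sg P N X s) :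
    Form.impl φ ψ ∈ T ↔ (φ ∈ T → ψ ∈ T) := by
  rw [Form.impl, hT.or_mem, hT.neg_mem, imp_iff_not_or]

theorem equiv_mem (hT : IsComplete Λ T) (φ ψ : Form Sg P N X s) :
    Form.equiv φ ψ ∈ T ↔ (φ ∈ T ↔ ψ ∈ T) := by
  simp only [Form.equiv, Form.conj, hT.neg_mem, hT.or_mem, hT.impl_mem]
  tauto

theorem mem_congr (hT : IsComplete Λ T) {φ ψ : Form Sg P N X s}
    (h : Prf Λ (Form.equiv φ ψ)) : φ ∈ T ↔ ψ ∈ T :=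
  (hT.equiv_mem φ ψ).1 (hT.thm h)

end IsComplete

/-! ### The operators -/

section Operators

variable {Λ : ∀ s, Set (Form Sg P N X s)} (σ : Sg.Op)

theorem Prf.box_mono (a : (i : Sg.arity σ) → Form Sg P N X (Sg.argSort i)) (i : Sg.arity σ)
    {φ χ : Form Sg P N X (Sg.argSort i)} (h : Prf Λ (Form.impl φ χ)) :
    Prf Λ (Form.impl (Form.box σ (Function.update a i φ))
      (Form.box σ (Function.update a i χ))) :=
  .mp (.axK σ a i φ χ) (.ug σ a i h)

theorem Prf.op_update_dual (a : (i : Sg.arity σ) → Form Sg P N X (Sg.argSort i))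
    (i : Sg.arity σ) (φ : Form Sg P N X (Sg.argSort i)) :
    Prf Λ (Form.equiv (Form.op σ (Function.update a i φ))
      (Form.neg (Form.box σ (Function.update (fun j => Form.neg (a j)) i (Form.neg φ))))) := by
  have h : Function.update (fun j => Form.neg (a j)) i (Form.neg φ) =
      fun j => Form.neg (Function.update a i φ j) := by
    funext j
    exact (Function.apply_update (fun _ => Form.neg) a i φ j).symm
  rw [h]
  exact .axDual σ _

theorem Prf.op_update_mono (a : (i : Sg.arity σ) → Form Sg P N X (Sg.argSort i))
    (i : Sg.arity σ) {φ χ : Form Sg P N X (Sg.argSort i)} (h : Prf Λ (Form.impl φ χ)) :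
    Prf Λ (Form.impl (Form.op σ (Function.update a i φ))
      (Form.op σ (Function.update a i χ))) := by
  have hneg : Prf Λ (Form.impl (Form.neg χ) (Form.neg φ)) := .of_taut
    (by intro v hn ho; simp only [Form.impl, hn, ho]; tauto) h
  have hbox := Prf.box_mono σ (fun j => Form.neg (a j)) i hneg
  refine .mp (.of_taut₂ ?_ (Prf.op_update_dual σ a i φ) (Prf.op_update_dual σ a i χ)) hbox
  intro v hn ho
  simp only [Form.impl, Form.equiv, Form.conj, hn, ho]
  tauto

theorem Prf.op_update_or (a : (i : Sg.arity σ) → Form Sg P N X (Sg.argSort i))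
    (i : Sg.arity σ) (φ χ : Form Sg P N X (Sg.argSort i)) :
    Prf Λ (Form.impl (Form.op σ (Function.update a i (Form.or φ χ)))
      (Form.or (Form.op σ (Function.update a i φ)) (Form.op σ (Function.update a i χ)))) := by
  have htaut : Prf Λ (Form.impl (Form.neg χ)
      (Form.impl (Form.neg φ) (Form.neg (Form.or φ χ)))) := .taut
    (by intro v hn ho; simp only [Form.impl, hn, ho]; tauto)
  have hbox := Prf.box_mono σ (fun j => Form.neg (a j)) i htaut
  have hK := Prf.axK (Λ := Λ) σ (fun j => Form.neg (a j)) i (Form.neg φ)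
    (Form.neg (Form.or φ χ))
  have hbox' := Prf.of_taut₂ (χ := Form.impl
      (Form.box σ (Function.update (fun j => Form.neg (a j)) i (Form.neg χ)))
      (Form.impl (Form.box σ (Function.update (fun j => Form.neg (a j)) i (Form.neg φ)))
        (Form.box σ (Function.update (fun j => Form.neg (a j)) i (Form.neg (Form.or φ χ))))))
    (by intro v hn ho; simp only [Form.impl, hn, ho]; tauto) hbox hK
  refine .mp (.mp (.of_taut₂ ?_ (Prf.op_update_dual σ a i φ) (Prf.op_update_dual σ a i χ))
    (Prf.op_update_dual σ a i (Form.or φ χ))) hbox'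
  intro v hn ho
  simp only [Form.impl, Form.equiv, Form.conj, hn, ho]
  tauto

theorem Prf.neg_op_update (a : (i : Sg.arity σ) → Form Sg P N X (Sg.argSort i))
    (i : Sg.arity σ) {φ : Form Sg P N X (Sg.argSort i)} (h : Prf Λ (Form.neg φ)) :
    Prf Λ (Form.neg (Form.op σ (Function.update a i φ))) := by
  refine .of_taut₂ ?_ (Prf.op_update_dual σ a i φ) (.ug σ (fun j => Form.neg (a j)) i h)
  intro v hn ho
  simp only [Form.impl, Form.equiv, Form.conj, hn, ho]
  tauto

end Operators

/-! ### Extension to families of complete theories -/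

/-- A predicate on finite tuples of formulas that behaves like a tuple of diamonds: it is
monotone, distributes over disjunctions and fails on refutable formulas. -/
structure IsPossibility (Λ : ∀ s, Set (Form Sg P N X s)) {ι : Type} [DecidableEq ι]
    (τ : ι → Sg.S) (Q : (∀ i, Form Sg P N X (τ i)) → Prop) : Prop where
  mono : ∀ a i φ χ, Prf Λ (Form.impl φ χ) →
    Q (Function.update a i φ) → Q (Function.update a i χ)
  or : ∀ a i φ χ, Q (Function.update a i (Form.or φ χ)) →
    Q (Function.update a i φ) ∨ Q (Function.update a i χ)
  not_of_neg : ∀ a i φ, Prf Λ (Form.neg φ) → ¬ Q (Function.update a i φ)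

namespace IsPossibility

variable {Λ : ∀ s, Set (Form Sg P N X s)} {ι : Type} [DecidableEq ι] [Finite ι]
  {τ : ι → Sg.S} {Q : (∀ i, Form Sg P N X (τ i)) → Prop}

theorem mono_all (hQ : IsPossibility Λ τ Q) {a b : ∀ i, Form Sg P N X (τ i)}
    (hab : ∀ i, Prf Λ (Form.impl (a i) (b i))) (ha : Q a) : Q b := by
  have := Fintype.ofFinite ι
  suffices h : ∀ s : Finset ι, Q (s.piecewise b a) by simpa using h Finset.univ
  intro s
  induction s using Finset.induction_on with
  | empty => simpa using ha
  | insert i s hi ih =>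
    rw [Finset.piecewise_insert]
    refine hQ.mono _ i (a i) (b i) (hab i) ?_
    rwa [← Finset.piecewise_eq_of_notMem s b a hi, Function.update_eq_self]

/-- Generalized Lindenbaum lemma: a family of theories all of whose selections are possible
extends to such a family consisting of complete theories. -/
theorem exists_isComplete (hQ : IsPossibility Λ τ Q) (a₀ : ∀ i, Form Sg P N X (τ i))
    {U₀ : ∀ i, Set (Form Sg P N X (τ i))}
    (hU₀ : ∀ i, IsTheory Λ (U₀ i)) (hQU₀ : ∀ a, (∀ i, a i ∈ U₀ i) → Q a) :
    ∃ U : ∀ i, Set (Form Sg P N X (τ i)), U₀ ≤ U ∧ (∀ i, IsComplete Λ (U i)) ∧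
      ∀ a, (∀ i, a i ∈ U i) → Q a := by
  obtain ⟨U, hle, hU⟩ := zorn_le_nonempty₀
    {U : ∀ i, Set (Form Sg P N X (τ i)) |
      (∀ i, IsTheory Λ (U i)) ∧ ∀ a, (∀ i, a i ∈ U i) → Q a} (by
      intro c hc hchain V hV
      have hdir : ∀ A ∈ c, ∀ B ∈ c, ∃ C ∈ c, A ≤ C ∧ B ≤ C := fun A hA B hB =>
        hchain.directedOn A hA B hB
      refine ⟨fun i => {φ | ∃ A ∈ c, φ ∈ A i}, ⟨fun i => ⟨fun h => ?_, ?_⟩, ?_⟩, ?_⟩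
      · exact ⟨V, hV, ((hc hV).1 i).thm h⟩
      · rintro φ ψ ⟨A, hA, hφ⟩ ⟨B, hB, hψ⟩
        obtain ⟨C, hC, hAC, hBC⟩ := hdir A hA B hB
        exact ⟨C, hC, ((hc hC).1 i).mp (hAC i hφ) (hBC i hψ)⟩
      · intro a ha
        choose A hA haA using ha
        have : Nonempty c := ⟨⟨V, hV⟩⟩
        have hd : Directed (· ≤ ·) (Subtype.val : c → ∀ i, Set (Form Sg P N X (τ i))) :=
          directedOn_iff_directed.1 hchain.directedOn
        obtain ⟨C, hC⟩ := hd.finite_le fun i => (⟨A i, hA i⟩ : c)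
        exact (hc C.2).2 a fun i => hC i i (haA i)
      · intro A hA i φ hφ
        exact ⟨A, hA, hφ⟩) U₀ ⟨hU₀, hQU₀⟩
  obtain ⟨⟨hT, hQU⟩, hmax⟩ := hU
  refine ⟨U, hle, fun i => ⟨hT i, fun φ => ⟨fun hneg hφ => ?_, fun hφ => ?_⟩⟩, hQU⟩
  · have hmem : ∀ j, Function.update (fun j => Form.impl (a₀ j) (a₀ j)) i
        (Form.conj φ (Form.neg φ)) j ∈ U j := by
      rw [Function.forall_update_iff _ (fun j ψ => ψ ∈ U j)]
      refine ⟨(hT i).of_taut₂ ?_ hφ hneg, fun j _ => (hT j).thm (.taut (a₀ j).tautology_impl_self)⟩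
      intro v hn ho
      simp only [Form.impl, Form.conj, hn, ho]
      tauto
    refine hQ.not_of_neg _ i _ (.taut ?_) (hQU _ hmem)
    intro v hn ho
    simp only [Form.conj, hn, ho]
    tauto
  · -- By maximality, if `χ ∉ U i` then adjoining `χ` to `U i` yields an impossible selection.
    have hadj : ∀ χ, χ ∉ U i → ∃ a : ∀ j, Form Sg P N X (τ j),
        Form.impl χ (a i) ∈ U i ∧ (∀ j, j ≠ i → a j ∈ U j) ∧ ¬ Q a := by
      intro χ hχ
      by_contra! hc
      refine hχ (hmax (y := Function.update U i {ψ | Form.impl χ ψ ∈ U i}) ⟨?_, ?_⟩ ?_ i ?_)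
      · rw [Function.forall_update_iff _ (fun j T => IsTheory Λ T)]
        exact ⟨(hT i).adjoin χ, fun j _ => hT j⟩
      · intro a ha
        rw [Function.forall_update_iff _ (fun j T => a j ∈ T)] at ha
        exact hc a ha.1 ha.2
      · rw [le_update_iff]
        refine ⟨fun ψ hψ => (hT i).of_taut ?_ hψ, fun j _ => le_rfl⟩
        intro v hn ho
        simp only [Form.impl, hn, ho]
        tauto
      · rw [Function.update_self]
        exact (hT i).thm (.taut χ.tautology_impl_self)
    by_contra hneg
    obtain ⟨a, hai, haj, hQa⟩ := hadj φ hφ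
    obtain ⟨b, hbi, hbj, hQb⟩ := hadj (Form.neg φ) hneg
    have hQc := hQU (Function.update (fun j => Form.conj (a j) (b j)) i (Form.or (a i) (b i))) (by
      rw [Function.forall_update_iff _ (fun j ψ => ψ ∈ U j)]
      refine ⟨(hT i).of_taut₂ ?_ hai hbi, fun j hj => (hT j).of_taut₂ ?_ (haj j hj) (hbj j hj)⟩ <;>
      · intro v hn ho
        simp only [Form.impl, Form.conj, hn, ho]
        tauto)
    rcases hQ.or _ _ _ _ hQc with h | h
    · refine hQa (hQ.mono_all (fun j => .taut ?_) h)
      rcases eq_or_ne j i with rfl | hj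
      · simpa using (a j).tautology_impl_self
      · intro v hn ho
        simp only [Form.impl, Form.conj, hn, ho, Function.update_of_ne hj]
        tauto
    · refine hQb (hQ.mono_all (fun j => .taut ?_) h)
      rcases eq_or_ne j i with rfl | hj
      · simpa using (b j).tautology_impl_self
      · intro v hn ho
        simp only [Form.impl, Form.conj, hn, ho, Function.update_of_ne hj]
        tauto

end IsPossibility

/-- Lindenbaum's lemma. -/
theorem Consistent.exists_isComplete {Λ : ∀ s, Set (Form Sg P N X s)} {s : Sg.S}
    {Γ : Set (Form Sg P N X s)} (hΓ : Consistent Λ Γ) (hne : Γ.Nonempty) :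
    ∃ T, Γ ⊆ T ∧ IsComplete Λ T := by
  have hQ : IsPossibility Λ (fun _ : Unit => s) fun a => ¬ Prf Λ (Form.neg (a ())) := by
    refine ⟨fun a i φ χ h => ?_, fun a i φ χ => ?_, fun a i φ h => ?_⟩
    · simp only [Function.update_self]
      exact mt fun h' => .of_taut₂
        (by intro v hn ho; simp only [Form.impl, hn, ho]; tauto) h h'
    · simp only [Function.update_self]
      rw [← not_and_or]
      exact mt fun h' => .of_taut₂
        (by intro v hn ho; simp only [Form.impl, hn, ho]; tauto) h'.1 h'.2
    · simpa only [Function.update_self, not_not] using h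
  obtain ⟨U, hle, hU, -⟩ := hQ.exists_isComplete (fun _ => hne.some)
    (fun _ => isTheory_generated Λ hne) (by
      rintro a ha h
      obtain ⟨φ, l, hφ, hl, h'⟩ := ha ()
      refine hΓ ⟨φ, l, hφ, hl, .of_taut₂ ?_ h' h⟩
      intro v hn ho
      simp only [Form.impl, hn, ho]
      tauto)
  refine ⟨U (), fun φ hφ => hle () ⟨φ, [], hφ, by simp, ?_⟩, hU ()⟩
  exact .taut φ.tautology_impl_self

theorem IsComplete.isPossibility_op {Λ : ∀ s, Set (Form Sg P N X s)} {σ : Sg.Op}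
    {T : Set (Form Sg P N X (Sg.cod σ))} (hT : IsComplete Λ T) :
    IsPossibility Λ (fun i : Sg.arity σ => Sg.argSort i) fun a => Form.op σ a ∈ T where
  mono a i _ _ h := hT.mp (hT.thm (Prf.op_update_mono σ a i h))
  or a i φ χ h := (hT.or_mem _ _).1 (hT.mp (hT.thm (Prf.op_update_or σ a i φ χ)) h)
  not_of_neg a i _ h := (hT.neg_mem _).1 (hT.thm (Prf.neg_op_update σ a i h))

/-! ### The canonical model of a complete theory

The worlds are all complete theories with the same `@`-formulas as a fixed complete theory `T`;
a dummy world, unrelated to all others, keeps every sort inhabited. -/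

section Canonical

variable (Λ : ∀ s, Set (Form Sg P N X s)) {s : Sg.S} (T : Set (Form Sg P N X s))

/-- Complete theories with the same `@`-formulas as `T`. -/
structure AtWorld (t : Sg.S) where
  carrier : Set (Form Sg P N X t)
  isComplete : IsComplete Λ carrier
  atf_mem : ∀ {u : Sg.S} (z : SSym N X u) (φ : Form Sg P N X u),
    Form.atf z φ ∈ carrier ↔ Form.atf z φ ∈ T

variable {Λ T}

theorem AtWorld.ext_carrier {t : Sg.S} {w w' : AtWorld Λ T t} (h : w.carrier = w'.carrier) :
    w = w' := by
  cases w
  cases w'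
  cases h
  rfl

/-- The complete theory `{φ | @_z φ ∈ T}` as a world. -/
def AtWorld.ofSSym (hT : IsComplete Λ T) {t : Sg.S} (z : SSym N X t) : AtWorld Λ T t where
  carrier := Dset T z
  isComplete :=
    { thm := fun h => hT.thm (.genAt z _ h)
      mp := fun h h' => hT.mp (hT.mp (hT.thm (.axKat z _ _)) h) h'
      neg_mem := fun φ => by
        have h := hT.mem_congr (.axSelfDual (s := s) z φ)
        rw [hT.neg_mem] at h
        change Form.atf z _ ∈ T ↔ Form.atf z φ ∉ T
        tauto }
  atf_mem y φ := hT.mem_congr (.axAgree z y φ)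

theorem AtWorld.ofSSym_mem_iff (hT : IsComplete Λ T) {t : Sg.S} (z : SSym N X t)
    (w : AtWorld Λ T t) : Form.ofSSym z ∈ w.carrier ↔ w = AtWorld.ofSSym hT z := by
  constructor
  · intro hz
    apply AtWorld.ext_carrier
    ext φ
    rw [(w.isComplete.equiv_mem _ _).1
      ((w.isComplete.impl_mem _ _).1 (w.isComplete.thm (.axIntro z φ)) hz), w.atf_mem]
    rfl
  · rintro rfl
    exact hT.thm (.axRef z)

/-- The canonical model of `T`. -/
def atModel (hT : IsComplete Λ T) : Model Sg P N where
  W t := Option (AtWorld Λ T t)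
  Wne _ := ⟨none⟩
  R σ w u := ∃ (w' : AtWorld Λ T (Sg.cod σ)) (u' : ∀ i, AtWorld Λ T (Sg.argSort i)),
    w = some w' ∧ (u = fun i => some (u' i)) ∧
      ∀ a, (∀ i, a i ∈ (u' i).carrier) → Form.op σ a ∈ w'.carrier
  Vp _ p := {w | ∃ w', w = some w' ∧ Form.prop p ∈ w'.carrier}
  Vn _ j := some (.ofSSym hT (.inl j))

/-- The assignment sending a state variable to the world it names. -/
def atAssign (hT : IsComplete Λ T) : ∀ t, X t → (atModel hT).W t :=
  fun _ x => some (.ofSSym hT (.inr x))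

theorem den_atModel (hT : IsComplete Λ T) {t : Sg.S} (z : SSym N X t) :
    (atModel hT).den (atAssign hT) z = some (.ofSSym hT z) := by
  cases z <;> rfl

theorem AtWorld.exists_of_op_mem {σ : Sg.Op} (w : AtWorld Λ T (Sg.cod σ))
    {args : ∀ i, Form Sg P N X (Sg.argSort i)} (h : Form.op σ args ∈ w.carrier) :
    ∃ u : ∀ i, AtWorld Λ T (Sg.argSort i), (∀ i, args i ∈ (u i).carrier) ∧
      ∀ a, (∀ i, a i ∈ (u i).carrier) → Form.op σ a ∈ w.carrier := by
  have hQ := w.isComplete.isPossibility_op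
  obtain ⟨U, hle, hU, hop⟩ := hQ.exists_isComplete args
    (fun i => isTheory_setOf_prf_impl Λ (args i)) fun a ha => hQ.mono_all ha h
  have hmem : ∀ i, args i ∈ U i := fun i => hle i (.taut (args i).tautology_impl_self)
  have hback : ∀ (i : Sg.arity σ) {t : Sg.S} (z : SSym N X t) (φ : Form Sg P N X t),
      Form.atf z φ ∈ U i → Form.atf z φ ∈ T := by
    intro i t z φ hφ
    rw [← w.atf_mem]
    refine w.isComplete.mp (w.isComplete.thm (.axBack σ args i z φ)) (hop _ ?_)
    rw [Function.forall_update_iff _ (fun j ψ => ψ ∈ U j)]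
    exact ⟨hφ, fun j _ => hmem j⟩
  refine ⟨fun i => ⟨U i, hU i, fun z φ => ⟨hback i z φ, fun hφ => ?_⟩⟩, hmem, hop⟩
  rw [(hU i).mem_congr (.axSelfDual z φ), (hU i).neg_mem]
  intro hneg
  have hneg' := hback i z _ hneg
  rw [← w.atf_mem] at hφ hneg'
  rw [w.isComplete.mem_congr (.axSelfDual z φ), w.isComplete.neg_mem] at hφ
  exact hφ hneg'

theorem sat_atModel_iff (hT : IsComplete Λ T) {t : Sg.S} (φ : Form Sg P N X t)
    (w : AtWorld Λ T t) : Sat (atModel hT) (atAssign hT) (some w) φ ↔ φ ∈ w.carrier := by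
  induction φ with
  | prop p =>
    constructor
    · rintro ⟨w', hw, hp⟩
      cases hw
      exact hp
    · exact fun hp => ⟨w, rfl, hp⟩
  | nom j =>
    refine Iff.trans ?_ (AtWorld.ofSSym_mem_iff hT (.inl j) w).symm
    exact Option.some_inj
  | svar x =>
    refine Iff.trans ?_ (AtWorld.ofSSym_mem_iff hT (.inr x) w).symm
    exact Option.some_inj
  | neg φ ih => rw [w.isComplete.neg_mem, ← ih]; rfl
  | or φ ψ ihφ ihψ => rw [w.isComplete.or_mem, ← ihφ, ← ihψ]; rfl
  | op σ args ih =>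
    constructor
    · rintro ⟨u, ⟨w', u', hw, rfl, hR⟩, hu⟩
      cases hw
      exact hR args fun i => (ih i _).1 (hu i)
    · intro h
      obtain ⟨u, hu, hR⟩ := w.exists_of_op_mem h
      exact ⟨fun i => some (u i), ⟨w, u, rfl, rfl, hR⟩, fun i => (ih i _).2 (hu i)⟩
  | atf z φ ih =>
    rw [w.atf_mem]
    change Sat (atModel hT) (atAssign hT) ((atModel hT).den (atAssign hT) z) φ ↔ _
    rw [den_atModel]
    exact ih _

end Canonical

/-- Completeness of `H_Σ(@_z)`: every consistent set of
formulas of sort `s` is satisfiable. -/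
theorem completeness {s : Sg.S} (Γ : Set (Form Sg P N X s))
    (hΓ : Consistent NoAx Γ) :
    ∃ (M : Model Sg P N) (g : ∀ t, X t → M.W t) (w : M.W s),
      ∀ φ ∈ Γ, Sat M g w φ := by
  rcases Γ.eq_empty_or_nonempty with rfl | hne
  · exact ⟨⟨fun _ => Unit, fun _ => ⟨()⟩, fun _ _ _ => True, fun _ _ => ∅, fun _ _ => ()⟩,
      fun _ _ => (), (), by simp⟩
  · obtain ⟨T, hΓT, hT⟩ := hΓ.exists_isComplete hne
    exact ⟨atModel hT, atAssign hT, some ⟨T, hT, fun _ _ => Iff.rfl⟩,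
      fun φ hφ => (sat_atModel_iff hT φ _).2 (hΓT hφ)⟩

end HybridMSHL
end
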